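/- arXiv:2211.12274 — 7 statements merged into one kernel-verified Lean document; each statement's English description precedes it below -/
import Mathlib

section
/- If ψ₁ and ψ₂ are both twice continuously differentiable solutions of the domain-wall equation ψ'' = U'(ψ) on ℝ with ψᵢ(t) → -1 as t → -∞, ψᵢ(t) → +1 as t → +∞, and ψ₁(0) = ψ₂(0) = 0, then ψ₁(t) = ψ₂(t) for all t ∈ ℝ. (Uniqueness part of Proposition 3.1.) -/
open Filter Topology

/-- A solution of `y'' = F(y)` with `F` of class `C¹` is determined by its position and velocity
at one time. -/
theorem eq_of_second_order_ode {F y z : ℝ → ℝ} (hF : ContDiff ℝ 1 F)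
    (hy : Differentiable ℝ y) (hy' : Differentiable ℝ (deriv y))
    (hz : Differentiable ℝ z) (hz' : Differentiable ℝ (deriv z))
    (hyF : ∀ t, deriv (deriv y) t = F (y t)) (hzF : ∀ t, deriv (deriv z) t = F (z t))
    {t₀ : ℝ} (h₀ : y t₀ = z t₀) (h₁ : deriv y t₀ = deriv z t₀) : y = z := by
  let v : ℝ × ℝ → ℝ × ℝ := fun p ↦ (p.2, F p.1)
  have hv : ContDiff ℝ 1 v := contDiff_snd.prodMk (hF.comp contDiff_fst)
  have phase : ∀ w : ℝ → ℝ, Differentiable ℝ w → Differentiable ℝ (deriv w) →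
      (∀ t, deriv (deriv w) t = F (w t)) →
      ∀ t, HasDerivAt (fun s ↦ (w s, deriv w s)) (v (w t, deriv w t)) t := by
    intro w hw hw' hwF t
    have h := (hw t).hasDerivAt.prodMk (hw' t).hasDerivAt
    rwa [hwF] at h
  have hY := phase y hy hy' hyF
  have hZ := phase z hz hz' hzF
  ext t
  obtain ⟨a, b, ht, ht₀⟩ : ∃ a b, t ∈ Set.Ioo a b ∧ t₀ ∈ Set.Ioo a b :=
    ⟨min t t₀ - 1, max t t₀ + 1, by grind⟩
  have bounded : ∀ f : ℝ → ℝ × ℝ, Continuous f →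
      ∃ R, ∀ s ∈ Set.Icc a b, ‖f s‖ ≤ R := fun f hf ↦
    isCompact_Icc.exists_bound_of_continuousOn hf.continuousOn
  obtain ⟨R, hR⟩ := bounded _ (hy.continuous.prodMk hy'.continuous)
  obtain ⟨S, hS⟩ := bounded _ (hz.continuous.prodMk hz'.continuous)
  obtain ⟨K, hK⟩ := hv.contDiffOn.exists_lipschitzOnWith one_ne_zero
    (convex_closedBall (0 : ℝ × ℝ) (max R S)) (isCompact_closedBall _ _)
  have key := ODE_solution_unique_of_mem_Ioo (v := fun _ ↦ v)
    (s := fun _ ↦ Metric.closedBall (0 : ℝ × ℝ) (max R S)) (fun _ _ ↦ hK) ht₀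
    (fun s hs ↦ ⟨hY s, mem_closedBall_zero_iff.2
      ((hR s (Set.Ioo_subset_Icc_self hs)).trans (le_max_left _ _))⟩)
    (fun s hs ↦ ⟨hZ s, mem_closedBall_zero_iff.2
      ((hS s (Set.Ioo_subset_Icc_self hs)).trans (le_max_right _ _))⟩)
    (Prod.ext h₀ h₁) ht
  exact congrArg Prod.fst key

/-- If a differentiable function converges at infinity, then its derivative tends to zero along
some sequence tending to infinity. -/
theorem exists_seq_deriv_tendsto_zero {f : ℝ → ℝ} {c : ℝ} (hf : Differentiable ℝ f)
    (hc : Tendsto f atTop (𝓝 c)) :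
    ∃ u : ℕ → ℝ, Tendsto u atTop atTop ∧ Tendsto (fun n ↦ deriv f (u n)) atTop (𝓝 0) := by
  have mvt : ∀ n : ℕ, ∃ x ∈ Set.Ioo (n : ℝ) (n + 1), deriv f x = f (n + 1) - f n := by
    intro n
    obtain ⟨x, hx, h⟩ := exists_deriv_eq_slope f (lt_add_one (n : ℝ)) hf.continuous.continuousOn
      hf.differentiableOn
    exact ⟨x, hx, by simpa using h⟩
  choose u hu hfu using mvt
  refine ⟨u, tendsto_atTop_mono (fun n ↦ (hu n).1.le) tendsto_natCast_atTop_atTop, ?_⟩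
  simp_rw [hfu]
  have hn : Tendsto (fun n : ℕ ↦ (n : ℝ)) atTop atTop := tendsto_natCast_atTop_atTop
  simpa using (hc.comp (tendsto_atTop_add_const_right _ 1 hn)).sub (hc.comp hn)

/-- If `y'' = U'(y)` and `y` converges to a zero `c` of `U` at infinity, then
`y' ^ 2 = 2 U(y)`. -/
theorem deriv_sq_eq_of_tendsto {U y : ℝ → ℝ} {c : ℝ} (hU : Differentiable ℝ U) (hUc : U c = 0)
    (hy : Differentiable ℝ y) (hy' : Differentiable ℝ (deriv y))
    (hode : ∀ t, deriv (deriv y) t = deriv U (y t)) (hc : Tendsto y atTop (𝓝 c)) (t : ℝ) :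
    deriv y t ^ 2 = 2 * U (y t) := by
  have hE : ∀ t, HasDerivAt (fun s ↦ deriv y s ^ 2 - 2 * U (y s)) 0 t := by
    intro t
    have h := ((hy' t).hasDerivAt.pow 2).sub
      (((hU (y t)).hasDerivAt.comp t (hy t).hasDerivAt).const_mul 2)
    rw [hode] at h
    refine h.congr_deriv ?_
    push_cast
    ring
  have hconst := is_const_of_deriv_eq_zero (fun t ↦ (hE t).differentiableAt) fun t ↦ (hE t).deriv
  obtain ⟨u, hu, hdu⟩ := exists_seq_deriv_tendsto_zero hy hc
  have hlim : Tendsto (fun n ↦ deriv y (u n) ^ 2 - 2 * U (y (u n))) atTop (𝓝 0) := by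
    simpa [hUc] using (hdu.pow 2).sub
      (((hU.continuous.tendsto c).comp (hc.comp hu)).const_mul 2)
  have h0 : deriv y t ^ 2 - 2 * U (y t) = 0 :=
    tendsto_nhds_unique (tendsto_const_nhds.congr fun n ↦ hconst t (u n)) hlim
  linarith

/-- If `y'' = U'(y)` and `y` converges to a zero `c` of `U` at infinity, then `c` is a critical
point of `U`. -/
theorem deriv_eq_zero_of_tendsto {U y : ℝ → ℝ} {c : ℝ} (hU : ContDiff ℝ 1 U) (hUc : U c = 0)
    (hy : Differentiable ℝ y) (hy' : Differentiable ℝ (deriv y))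
    (hode : ∀ t, deriv (deriv y) t = deriv U (y t)) (hc : Tendsto y atTop (𝓝 c)) :
    deriv U c = 0 := by
  have hdU : Differentiable ℝ U := hU.differentiable one_ne_zero
  have hsq : Tendsto (fun t ↦ deriv y t ^ 2) atTop (𝓝 0) := by
    simp_rw [deriv_sq_eq_of_tendsto hdU hUc hy hy' hode hc]
    simpa [hUc] using ((hU.continuous.tendsto c).comp hc).const_mul 2
  have hvel : Tendsto (deriv y) atTop (𝓝 0) := by
    rw [tendsto_zero_iff_abs_tendsto_zero]
    simpa [Function.comp_def, Real.sqrt_sq_eq_abs] using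
      (Real.continuous_sqrt.tendsto 0).comp hsq
  obtain ⟨u, hu, hdu⟩ := exists_seq_deriv_tendsto_zero hy' hvel
  simp_rw [hode] at hdu
  exact tendsto_nhds_unique
    (((hU.continuous_deriv le_rfl).tendsto c).comp (hc.comp hu)) hdu

/-- A domain wall crosses `0` with positive velocity, which is determined by the energy
identity. -/
theorem deriv_zero_eq_sqrt {U y : ℝ → ℝ} (hU : ContDiff ℝ 2 U) (hEven : ∀ s, U (-s) = U s)
    (hU1 : U 1 = 0) (hUpos : ∀ s, -1 < s → s < 1 → 0 < U s) (hy : ContDiff ℝ 2 y)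
    (hode : ∀ t, deriv (deriv y) t = deriv U (y t)) (htop : Tendsto y atTop (𝓝 1))
    (h0 : y 0 = 0) : deriv y 0 = √(2 * U 0) := by
  have hdU : Differentiable ℝ U := hU.differentiable two_ne_zero
  have hy₁ : Differentiable ℝ y := hy.differentiable two_ne_zero
  have hy₂ : Differentiable ℝ (deriv y) := hy.differentiable_deriv_two
  have hsq := deriv_sq_eq_of_tendsto hdU hU1 hy₁ hy₂ hode htop
  have hcrit : deriv U (-1) = 0 := by
    have h := deriv_comp_neg U 1
    rw [funext hEven,
      deriv_eq_zero_of_tendsto (hU.of_le one_le_two) hU1 hy₁ hy₂ hode htop] at h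
    linarith
  have hne : ∀ t, y t ≠ -1 := by
    intro t ht
    have hvel : deriv y t = 0 := by
      have := hsq t
      rwa [ht, hEven, hU1, mul_zero, sq_eq_zero_iff] at this
    have hdU' : ContDiff ℝ 1 (deriv U) := hU.deriv'
    have h := eq_of_second_order_ode (z := fun _ ↦ -1) hdU' hy₁ hy₂ (by fun_prop)
      (by simp) hode (by simp [hcrit]) ht (by simpa using hvel)
    have := congrFun h 0
    norm_num [h0] at this
  have hgt : ∀ t, -1 < y t := by
    intro t
    by_contra! hle
    obtain ⟨s, hs⟩ := mem_range_of_exists_le_of_exists_ge hy.continuous ⟨t, hle⟩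
      ⟨0, by norm_num [h0]⟩
    exact hne s hs
  suffices hpos : 0 ≤ deriv y 0 by
    have h := hsq 0
    rw [h0] at h
    rw [← h, Real.sqrt_sq hpos]
  by_contra! hneg
  obtain ⟨T, hT, hyT⟩ : ∃ T > 0, 0 < y T :=
    ((eventually_gt_atTop 0).and (htop.eventually (lt_mem_nhds one_pos))).exists
  obtain ⟨m, hm, hmin⟩ := isCompact_Icc.exists_isMinOn (Set.nonempty_Icc.2 hT.le)
    (hy.continuous.continuousOn (s := Set.Icc 0 T))
  obtain ⟨s, hs, hys⟩ : ∃ s ∈ Set.Ioo 0 T, y s < 0 := by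
    have hev := (hasDerivAt_iff_tendsto_slope.1 (hy₁ 0).hasDerivAt).eventually
      (gt_mem_nhds hneg)
    have hev' : ∀ᶠ s in 𝓝[>] (0 : ℝ), slope y 0 s < 0 :=
      hev.filter_mono (nhdsWithin_mono _ fun s hs ↦ ne_of_gt hs)
    obtain ⟨s, hslope, hs⟩ := (hev'.and (Ioo_mem_nhdsGT hT)).exists
    refine ⟨s, hs, ?_⟩
    rw [slope_def_field, h0, sub_zero, sub_zero] at hslope
    by_contra! hnn
    exact hslope.not_ge (div_nonneg hnn hs.1.le)
  have hym : y m < 0 := (hmin (Set.Ioo_subset_Icc_self hs)).trans_lt hys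
  have hm' : m ∈ Set.Ioo 0 T := by
    refine ⟨hm.1.lt_of_ne ?_, hm.2.lt_of_ne ?_⟩
    · rintro rfl
      exact hym.ne h0
    · rintro rfl
      exact hym.not_gt hyT
  have hdm : deriv y m = 0 :=
    (hmin.isLocalMin (Icc_mem_nhds hm'.1 hm'.2)).deriv_eq_zero
  have hm₀ := hsq m
  have := hUpos (y m) (hgt m) (by linarith)
  rw [hdm] at hm₀
  linarith

/-- Uniqueness part of Proposition 3.1: two C² solutions of the domain-wall
equation `ψ'' = U'(ψ)` with the heteroclinic boundary conditions and the same
normalization `ψ(0) = 0` coincide. -/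
theorem domain_wall_uniqueness
    (U : ℝ → ℝ)
    (hU : ContDiff ℝ 2 U)
    (hEven : ∀ s, U (-s) = U s)
    (hU1 : U 1 = 0) (hUm1 : U (-1) = 0)
    (hUpos : ∀ s, -1 < s → s < 1 → 0 < U s)
    (hU''1 : deriv (deriv U) 1 = 1) (hU''m1 : deriv (deriv U) (-1) = 1)
    (ψ₁ ψ₂ : ℝ → ℝ)
    (hψ₁ : ContDiff ℝ 2 ψ₁) (hψ₂ : ContDiff ℝ 2 ψ₂)
    (hode₁ : ∀ t, deriv (deriv ψ₁) t = deriv U (ψ₁ t))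
    (hode₂ : ∀ t, deriv (deriv ψ₂) t = deriv U (ψ₂ t))
    (hbot₁ : Tendsto ψ₁ atBot (𝓝 (-1))) (htop₁ : Tendsto ψ₁ atTop (𝓝 1))
    (hbot₂ : Tendsto ψ₂ atBot (𝓝 (-1))) (htop₂ : Tendsto ψ₂ atTop (𝓝 1))
    (h0₁ : ψ₁ 0 = 0) (h0₂ : ψ₂ 0 = 0) :
    ∀ t, ψ₁ t = ψ₂ t := by
  have h₁ := deriv_zero_eq_sqrt hU hEven hU1 hUpos hψ₁ hode₁ htop₁ h0₁
  have h₂ := deriv_zero_eq_sqrt hU hEven hU1 hUpos hψ₂ hode₂ htop₂ h0₂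
  have hdU : ContDiff ℝ 1 (deriv U) := hU.deriv'
  exact congrFun (eq_of_second_order_ode hdU (hψ₁.differentiable two_ne_zero)
    hψ₁.differentiable_deriv_two (hψ₂.differentiable two_ne_zero)
    hψ₂.differentiable_deriv_two hode₁ hode₂ (h0₁.trans h0₂.symm) (h₁.trans h₂.symm))
end

section
/- Any twice continuously differentiable solution ψ of ψ'' = U'(ψ) on ℝ with ψ(t) → -1 as t → -∞ and ψ(t) → +1 as t → +∞ satisfies -1 < ψ(t) < 1 and ψ'(t) > 0 for all t ∈ ℝ; in particular ψ is a strictly increasing heteroclinic (kink) profile interpolating between the two minima ±1 of the double-well potential U. -/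
open Filter Topology

/-- If `f` is differentiable and converges at `+∞`, then the only possible limit of `g ∘ f'`
at `+∞`, for `g` continuous, is `g 0`. -/
theorem limit_comp_deriv_eq_of_tendsto_atTop {f g : ℝ → ℝ} {a L : ℝ}
    (hf : Differentiable ℝ f) (hfa : Tendsto f atTop (𝓝 a)) (hg : Continuous g)
    (hL : Tendsto (fun t => g (deriv f t)) atTop (𝓝 L)) : L = g 0 := by
  have hmvt : ∀ t : ℝ, ∃ c ∈ Set.Ioo t (t + 1), deriv f c = (f (t + 1) - f t) / (t + 1 - t) :=
    fun t => exists_deriv_eq_slope f (by linarith) hf.continuous.continuousOn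
      hf.differentiableOn
  choose c hc hslope using hmvt
  have hc_top : Tendsto c atTop atTop := tendsto_atTop_mono (fun t => (hc t).1.le) tendsto_id
  have hzero : Tendsto (fun t => deriv f (c t)) atTop (𝓝 0) := by
    have hdiff := (hfa.comp (tendsto_atTop_add_const_right atTop 1 tendsto_id)).sub hfa
    rw [sub_self] at hdiff
    refine hdiff.congr fun t => ?_
    simp [hslope]
  exact tendsto_nhds_unique (hL.comp hc_top) ((hg.tendsto 0).comp hzero)

/-- A solution of `ψ'' = F(ψ)`, with `F` of class `C¹`, that passes through an equilibrium `c`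
with zero velocity is constant. -/
theorem eq_const_of_second_order_ode {F ψ : ℝ → ℝ} {c t₀ : ℝ} (hF : ContDiff ℝ 1 F)
    (hFc : F c = 0) (hψ : Differentiable ℝ ψ) (hψ' : Differentiable ℝ (deriv ψ))
    (hode : ∀ t, deriv (deriv ψ) t = F (ψ t)) (h₀ : ψ t₀ = c) (h₀' : deriv ψ t₀ = 0) (t : ℝ) :
    ψ t = c := by
  obtain ⟨A, B, ht, ht₀⟩ : ∃ A B, t ∈ Set.Ioo A B ∧ t₀ ∈ Set.Ioo A B :=
    ⟨min t t₀ - 1, max t t₀ + 1, by constructor <;> grind, by constructor <;> grind⟩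
  have hcont : Continuous fun s => (ψ s, deriv ψ s) := hψ.continuous.prodMk hψ'.continuous
  obtain ⟨R, hR⟩ := ((isCompact_Icc (a := A) (b := B)).image hcont).isBounded.subset_closedBall
    ((c, 0) : ℝ × ℝ)
  have hv : ContDiff ℝ 1 fun p : ℝ × ℝ => (p.2, F p.1) :=
    contDiff_snd.prodMk (hF.comp contDiff_fst)
  obtain ⟨K, hK⟩ := hv.contDiffOn.exists_lipschitzOnWith one_ne_zero
    (convex_closedBall ((c, 0) : ℝ × ℝ) R) (isCompact_closedBall _ _)
  have hmem : ∀ s ∈ Set.Ioo A B, (ψ s, deriv ψ s) ∈ Metric.closedBall ((c, 0) : ℝ × ℝ) R :=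
    fun s hs => hR ⟨s, Set.Ioo_subset_Icc_self hs, rfl⟩
  have hR0 : 0 ≤ R := dist_nonneg.trans (Metric.mem_closedBall.1 (hmem t ht))
  have heq := ODE_solution_unique_of_mem_Ioo (v := fun _ p => (p.2, F p.1))
    (s := fun _ => Metric.closedBall ((c, 0) : ℝ × ℝ) R) (f := fun s => (ψ s, deriv ψ s))
    (g := fun _ => (c, 0)) (fun _ _ => hK) ht₀
    (fun s hs => ⟨by
      have := (hψ s).hasDerivAt.prodMk (hψ' s).hasDerivAt
      rwa [hode] at this, hmem s hs⟩)
    (fun s _ => ⟨by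
      simp only [hFc]
      exact hasDerivAt_const s ((c, 0) : ℝ × ℝ), Metric.mem_closedBall_self hR0⟩)
    (by simp [h₀, h₀'])
  exact congrArg Prod.fst (heq ht)

/-- The energy `ψ'² - 2 U(ψ)` of a solution of `ψ'' = U'(ψ)` vanishes when `ψ` converges at `+∞`
to a zero of `U`. -/
theorem sq_deriv_eq_of_tendsto_atTop {U ψ : ℝ → ℝ} {a : ℝ} (hU : Differentiable ℝ U)
    (hψ : Differentiable ℝ ψ) (hψ' : Differentiable ℝ (deriv ψ))
    (hode : ∀ t, deriv (deriv ψ) t = deriv U (ψ t))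
    (hUa : U a = 0) (htop : Tendsto ψ atTop (𝓝 a)) (t : ℝ) :
    deriv ψ t ^ 2 = 2 * U (ψ t) := by
  have hderiv : ∀ s, HasDerivAt (fun s => deriv ψ s ^ 2 - 2 * U (ψ s)) 0 s := fun s => by
    have h := ((hψ' s).hasDerivAt.pow 2).sub
      (((hU (ψ s)).hasDerivAt.comp s (hψ s).hasDerivAt).const_mul 2)
    rw [hode] at h
    refine h.congr_deriv ?_
    ring
  have hconst : ∀ s, deriv ψ s ^ 2 - 2 * U (ψ s) = deriv ψ t ^ 2 - 2 * U (ψ t) := fun s =>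
    is_const_of_deriv_eq_zero (fun s => (hderiv s).differentiableAt)
      (fun s => (hderiv s).deriv) s t
  have hUψ : Tendsto (fun s => 2 * U (ψ s)) atTop (𝓝 0) := by
    simpa [hUa] using ((hU.continuous.tendsto a).comp htop).const_mul 2
  have hlim : Tendsto (fun s => deriv ψ s ^ 2) atTop (𝓝 (deriv ψ t ^ 2 - 2 * U (ψ t))) := by
    have h := hUψ.add_const (deriv ψ t ^ 2 - 2 * U (ψ t))
    rw [zero_add] at h
    refine h.congr fun s => ?_
    rw [← hconst s]
    ring
  have h0 := limit_comp_deriv_eq_of_tendsto_atTop hψ htop (continuous_pow 2) hlim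
  linarith

/-- Any C² heteroclinic solution of `ψ'' = U'(ψ)` with `ψ(t) → ∓1` as
`t → ∓∞` satisfies `-1 < ψ(t) < 1` and `ψ'(t) > 0` for all `t`; in particular
`ψ` is a strictly increasing kink profile interpolating between `±1`. -/
theorem domain_wall_monotone_kink
    (U : ℝ → ℝ)
    (hU : ContDiff ℝ 2 U)
    (hEven : ∀ s, U (-s) = U s)
    (hU1 : U 1 = 0) (hUm1 : U (-1) = 0)
    (hUpos : ∀ s, -1 < s → s < 1 → 0 < U s)
    (hU''1 : deriv (deriv U) 1 = 1) (hU''m1 : deriv (deriv U) (-1) = 1)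
    (ψ : ℝ → ℝ)
    (hψ : ContDiff ℝ 2 ψ)
    (hode : ∀ t, deriv (deriv ψ) t = deriv U (ψ t))
    (hbot : Tendsto ψ atBot (𝓝 (-1))) (htop : Tendsto ψ atTop (𝓝 1)) :
    (∀ t : ℝ, -1 < ψ t ∧ ψ t < 1 ∧ 0 < deriv ψ t) ∧ StrictMono ψ := by
  have hU' : ContDiff ℝ 1 (deriv U) := hU.deriv'
  have hUd : Differentiable ℝ U := hU.differentiable two_ne_zero
  have hψd : Differentiable ℝ ψ := hψ.differentiable two_ne_zero
  have hψ1 : ContDiff ℝ 1 (deriv ψ) := hψ.deriv'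
  have hψ'd : Differentiable ℝ (deriv ψ) := hψ1.differentiable one_ne_zero
  have henergy := sq_deriv_eq_of_tendsto_atTop hUd hψd hψ'd hode hU1 htop
  have hψ'0 : Tendsto (deriv ψ) atTop (𝓝 0) := by
    have hsq : Tendsto (fun t => deriv ψ t ^ 2) atTop (𝓝 0) := by
      simp only [henergy]
      simpa [hU1] using ((hUd.continuous.tendsto 1).comp htop).const_mul 2
    rw [tendsto_zero_iff_abs_tendsto_zero]
    simpa [Function.comp_def, Real.sqrt_sq_eq_abs] using hsq.sqrt
  have hcrit : deriv U 1 = 0 := by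
    refine limit_comp_deriv_eq_of_tendsto_atTop hψ'd hψ'0 continuous_id ?_
    simp only [id, hode]
    exact (hU'.continuous.tendsto 1).comp htop
  have hcrit' : deriv U (-1) = 0 := by
    have h := deriv_comp_neg U 1
    rw [funext hEven, hcrit] at h
    linarith
  have hvel : ∀ t, U (ψ t) = 0 → deriv ψ t = 0 := fun t ht => by
    simpa [ht] using henergy t
  have hne1 : ∀ t, ψ t ≠ 1 := fun t₀ h₀ => by
    have hconst := eq_const_of_second_order_ode hU' hcrit hψd hψ'd hode h₀
      (hvel t₀ (h₀ ▸ hU1))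
    rw [funext hconst] at hbot
    have := tendsto_nhds_unique hbot tendsto_const_nhds
    norm_num at this
  have hneg1 : ∀ t, ψ t ≠ -1 := fun t₀ h₀ => by
    have hconst := eq_const_of_second_order_ode hU' hcrit' hψd hψ'd hode h₀
      (hvel t₀ (h₀ ▸ hUm1))
    rw [funext hconst] at htop
    have := tendsto_nhds_unique htop tendsto_const_nhds
    norm_num at this
  have hlt : ∀ t, ψ t < 1 := fun t => by
    by_contra! h
    obtain ⟨s, hs⟩ := (hbot.eventually_lt_const (by norm_num : (-1 : ℝ) < 1)).exists
    obtain ⟨r, hr⟩ := mem_range_of_exists_le_of_exists_ge hψ.continuous ⟨s, hs.le⟩ ⟨t, h⟩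
    exact hne1 r hr
  have hgt : ∀ t, -1 < ψ t := fun t => by
    by_contra! h
    obtain ⟨s, hs⟩ := (htop.eventually_const_lt (by norm_num : (-1 : ℝ) < 1)).exists
    obtain ⟨r, hr⟩ := mem_range_of_exists_le_of_exists_ge hψ.continuous ⟨t, h⟩ ⟨s, hs.le⟩
    exact hneg1 r hr
  have hderiv_ne : ∀ t, deriv ψ t ≠ 0 := fun t h => by
    have := henergy t
    have := hUpos _ (hgt t) (hlt t)
    simp_all
  have hpos : ∀ t, 0 < deriv ψ t := fun t => by
    by_contra! h
    have hnonpos : ∀ s, deriv ψ s ≤ 0 := fun s => by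
      by_contra! hs
      obtain ⟨r, hr⟩ := mem_range_of_exists_le_of_exists_ge hψ1.continuous ⟨t, h⟩ ⟨s, hs.le⟩
      exact hderiv_ne r hr
    have hanti := antitone_of_deriv_nonpos hψd hnonpos
    have h1 := hanti.le_of_tendsto htop 0
    have h2 := hlt 0
    linarith
  exact ⟨fun t => ⟨hgt t, hlt t, hpos t⟩, strictMono_of_deriv_pos hpos⟩
end

section
/- Suppose the Korn-type inequality holds with a constant C > 0: for every continuously differentiable Λ₀-periodic v : ℝ² → ℝ² with ∫_{Γ₀} v dx = 0 one has ∫_{Γ₀} (λ (div v)² + 2μ ε(v):ε(v)) dx ≥ μ C ‖v‖²_{1,2}. Then every continuously differentiable Λ₀-periodic u* : ℝ² → ℝ² with ∫_{Γ₀} u* dx = 0 satisfying E₀^θ[u*] ≤ E₀^θ[0] (in particular every minimizer of E₀^θ among such maps) satisfies ‖u*‖_{1,2} ≤ (1/(2|sin(θ/2)|)) · ( (1/(μ C)) ∫_{Γ₀} (Ψ₀(x) - Ψ_min) dx )^{1/2}. (Theorem 4.1: the L²-Sobolev norm of the relaxation displacement scales at most inversely linearly with the twist angle.) -/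
open Matrix MeasureTheory Real

noncomputable section

/-- The fundamental cell `B[0,1)²` of the lattice `Bℤ²`. -/
def cell (B : Matrix (Fin 2) (Fin 2) ℝ) : Set (Fin 2 → ℝ) :=
  (fun ξ => B.mulVec ξ) '' (Set.univ.pi fun _ => Set.Ico (0 : ℝ) 1)

/-- Periodicity with respect to the lattice `Bℤ²`. -/
def PeriodicWrt {α : Type*} (B : Matrix (Fin 2) (Fin 2) ℝ) (f : (Fin 2 → ℝ) → α) : Prop :=
  ∀ (x : Fin 2 → ℝ) (m : Fin 2 → ℤ), f (x + B.mulVec fun i => (m i : ℝ)) = f x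

/-- The gradient matrix `(∇u)_{ij} = ∂_j u_i` of a map `u : ℝ² → ℝ²`. -/
def gradm (u : (Fin 2 → ℝ) → (Fin 2 → ℝ)) (x : Fin 2 → ℝ) : Matrix (Fin 2) (Fin 2) ℝ :=
  fun i j => fderiv ℝ u x (Pi.single j 1) i

/-- The divergence `div u = ∑ᵢ ∂ᵢuᵢ`. -/
def divg (u : (Fin 2 → ℝ) → (Fin 2 → ℝ)) (x : Fin 2 → ℝ) : ℝ :=
  ∑ i, fderiv ℝ u x (Pi.single i 1) i

/-- The symmetric linear strain tensor `ε(u) = (∇u + (∇u)ᵀ)/2`. -/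
def strain (u : (Fin 2 → ℝ) → (Fin 2 → ℝ)) (x : Fin 2 → ℝ) : Matrix (Fin 2) (Fin 2) ℝ :=
  (1 / 2 : ℝ) • (gradm u x + (gradm u x)ᵀ)

/-- Frobenius contraction `M : M = ∑ᵢⱼ Mᵢⱼ²`. -/
def frob (M : Matrix (Fin 2) (Fin 2) ℝ) : ℝ := ∑ i, ∑ j, (M i j) ^ 2

/-- The rotation matrix `R_φ`. -/
def Rot (φ : ℝ) : Matrix (Fin 2) (Fin 2) ℝ :=
  !![Real.cos φ, -Real.sin φ; Real.sin φ, Real.cos φ]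

/-- `J = R_{-π/2}`. -/
def Jm : Matrix (Fin 2) (Fin 2) ℝ := !![0, 1; -1, 0]

/-- The squared periodic Sobolev norm `‖u‖²_{1,2} = ∫_{Γ₀} (|u|² + |∇u|²)`. -/
def sobSq (B : Matrix (Fin 2) (Fin 2) ℝ) (u : (Fin 2 → ℝ) → (Fin 2 → ℝ)) : ℝ :=
  ∫ x in cell B, ((∑ i, (u x i) ^ 2) + ∑ i, ∑ j, (gradm u x i j) ^ 2)

/-- The intralayer elastic energy on the cell of `Bℤ²`. -/
def Eintra (B : Matrix (Fin 2) (Fin 2) ℝ) (lam mu : ℝ)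
    (u : (Fin 2 → ℝ) → (Fin 2 → ℝ)) : ℝ :=
  ∫ x in cell B, ((lam / 2) * (divg u x) ^ 2 + mu * frob (strain u x))

/-- The rescaled total energy `E₀^θ[u]` of the twisted bilayer on the
angle-independent reference cell `Γ₀ = (JA)[0,1)²`. -/
def E0 (A : Matrix (Fin 2) (Fin 2) ℝ) (θ lam mu : ℝ) (Ψ : (Fin 2 → ℝ) → ℝ)
    (u : (Fin 2 → ℝ) → (Fin 2 → ℝ)) : ℝ :=
  2 * Eintra (Jm * A) lam mu u +
    (1 / (8 * Real.sin (θ / 2) ^ 2)) *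
      ∫ x in cell (Jm * A),
        (Ψ (x - (2 : ℝ) • (Jm * Rot (θ / 2)).mulVec (u x)) +
         Ψ (x - (2 : ℝ) • (Jm * Rot (-(θ / 2))).mulVec (u x)))

/-- Continuous functions are integrable on a fundamental cell, which is bounded. -/
theorem integrableOn_cell (B : Matrix (Fin 2) (Fin 2) ℝ) {f : (Fin 2 → ℝ) → ℝ}
    (hf : Continuous f) : IntegrableOn f (cell B) := by
  have hK : IsCompact ((fun ξ => B.mulVec ξ) ''
      (Set.univ.pi fun _ : Fin 2 => Set.Icc (0 : ℝ) 1)) :=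
    (isCompact_univ_pi fun _ => isCompact_Icc).image (by fun_prop)
  exact (hf.continuousOn.integrableOn_compact hK).mono_set
    (Set.image_mono (Set.pi_mono fun _ _ => Set.Ico_subset_Icc_self))

/-- Theorem 4.1: under a Korn-type inequality with constant `C > 0`, every
mean-zero periodic `C¹` displacement `u*` with `E₀^θ[u*] ≤ E₀^θ[0]` (in
particular every minimizer) satisfies
`‖u*‖_{1,2} ≤ (1/(2|sin(θ/2)|)) ((1/(μC)) ∫_{Γ₀} (Ψ₀ - Ψ_min))^{1/2}`. -/
theorem twisted_relaxation_estimate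
    (A : Matrix (Fin 2) (Fin 2) ℝ) (hA : IsUnit A.det)
    (θ : ℝ) (hθ : Real.sin (θ / 2) ≠ 0)
    (lam mu : ℝ) (hlam : 0 ≤ lam) (hmu : 0 < mu)
    (Ψ : (Fin 2 → ℝ) → ℝ) (hΨc : Continuous Ψ) (hΨp : PeriodicWrt (Jm * A) Ψ)
    (Ψmin : ℝ) (hmin : ∀ x, Ψmin ≤ Ψ x) (hatt : ∃ x, Ψ x = Ψmin)
    (C : ℝ) (hC : 0 < C)
    (hKorn : ∀ v : (Fin 2 → ℝ) → (Fin 2 → ℝ), ContDiff ℝ 1 v → PeriodicWrt (Jm * A) v →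
      (∫ x in cell (Jm * A), v x) = 0 →
      (∫ x in cell (Jm * A), (lam * (divg v x) ^ 2 + 2 * mu * frob (strain v x)))
        ≥ mu * C * sobSq (Jm * A) v)
    (u : (Fin 2 → ℝ) → (Fin 2 → ℝ)) (hu : ContDiff ℝ 1 u)
    (hup : PeriodicWrt (Jm * A) u)
    (humean : (∫ x in cell (Jm * A), u x) = 0)
    (hle : E0 A θ lam mu Ψ u ≤ E0 A θ lam mu Ψ (fun _ => 0)) :
    Real.sqrt (sobSq (Jm * A) u) ≤
      (1 / (2 * |Real.sin (θ / 2)|)) *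
        Real.sqrt ((1 / (mu * C)) * ∫ x in cell (Jm * A), (Ψ x - Ψmin)) := by
  have hK := hKorn u hu hup humean
  have hE : 2 * Eintra (Jm * A) lam mu u =
      ∫ x in cell (Jm * A), (lam * (divg u x) ^ 2 + 2 * mu * frob (strain u x)) := by
    rw [Eintra, ← integral_const_mul]
    congr 1
    ext x
    ring
  have hE_zero : Eintra (Jm * A) lam mu (fun _ => 0) = 0 := by
    simp [Eintra, divg, strain, gradm, frob]
  have huc := hu.continuous
  have hΨi := integrableOn_cell (Jm * A) hΨc
  have hci := integrableOn_cell (Jm * A) (continuous_const (y := Ψmin))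
  have hmisfit : (∫ _ in cell (Jm * A), Ψmin) + (∫ _ in cell (Jm * A), Ψmin) ≤
      ∫ x in cell (Jm * A),
        (Ψ (x - (2 : ℝ) • (Jm * Rot (θ / 2)).mulVec (u x)) +
         Ψ (x - (2 : ℝ) • (Jm * Rot (-(θ / 2))).mulVec (u x))) := by
    rw [← integral_add hci hci]
    exact setIntegral_mono (hci.add hci) (integrableOn_cell _ (by fun_prop))
      fun x => add_le_add (hmin _) (hmin _)
  rw [E0, E0, hE, hE_zero] at hle
  simp only [Matrix.mulVec_zero, smul_zero, sub_zero, mul_zero, zero_add] at hle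
  rw [integral_add hΨi hΨi] at hle
  rw [integral_sub hΨi hci]
  have hs : 0 < Real.sin (θ / 2) ^ 2 := by positivity
  have hmul := mul_le_mul_of_nonneg_left hmisfit
    (show 0 ≤ 1 / (8 * Real.sin (θ / 2) ^ 2) by positivity)
  set a := ∫ x in cell (Jm * A), Ψ x
  set b := ∫ _ in cell (Jm * A), Ψmin
  have hbound : mu * C * sobSq (Jm * A) u ≤ 1 / (4 * Real.sin (θ / 2) ^ 2) * (a - b) := by
    have hfactor : 1 / (4 * Real.sin (θ / 2) ^ 2) * (a - b) =
        1 / (8 * Real.sin (θ / 2) ^ 2) * (a + a) - 1 / (8 * Real.sin (θ / 2) ^ 2) * (b + b) := by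
      field_simp
      ring
    linarith
  have hsq : sobSq (Jm * A) u ≤
      (1 / (2 * |Real.sin (θ / 2)|)) ^ 2 * (1 / (mu * C) * (a - b)) := by
    have hmuC : 0 < mu * C := mul_pos hmu hC
    rw [div_pow, mul_pow, sq_abs]
    refine le_of_mul_le_mul_left (hbound.trans_eq ?_) hmuC
    field_simp
    norm_num
  refine (Real.sqrt_le_sqrt hsq).trans_eq ?_
  rw [Real.sqrt_mul (sq_nonneg _), Real.sqrt_sq (by positivity)]
end
end

section
/- Let A₁, A₂ be invertible real 2×2 matrices with A₁⁻¹ - A₂⁻¹ invertible and A_M = (A₁⁻¹ - A₂⁻¹)⁻¹. Then (I - A₁A₂⁻¹) A_M = A₁; consequently the linear map x ↦ (I - A₁A₂⁻¹)x maps the moiré lattice A_Mℤ² bijectively onto the lattice A₁ℤ² and induces an additive group isomorphism between the tori ℝ²/A_Mℤ² and ℝ²/A₁ℤ². (The disregistry b₂₁ is an isomorphism from the moiré cell Γ_M to the unit cell Γ₁.) -/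
open Matrix

/-- The lattice `Bℤ²` generated by the columns of `B`, as an additive subgroup
of `ℝ²`. -/
def lat (B : Matrix (Fin 2) (Fin 2) ℝ) : AddSubgroup (Fin 2 → ℝ) where
  carrier := { v | ∃ m : Fin 2 → ℤ, v = B.mulVec fun i => (m i : ℝ) }
  zero_mem' := ⟨0, by
    rw [show (fun i => (((0 : Fin 2 → ℤ) i : ℝ))) = 0 by funext i; simp]
    rw [Matrix.mulVec_zero]⟩
  add_mem' := by
    rintro a b ⟨m, rfl⟩ ⟨n, rfl⟩
    refine ⟨m + n, ?_⟩
    rw [show (fun i => ((m + n) i : ℝ)) = (fun i => (m i : ℝ)) + fun i => (n i : ℝ) by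
      funext i; simp]
    rw [Matrix.mulVec_add]
  neg_mem' := by
    rintro a ⟨m, rfl⟩
    refine ⟨-m, ?_⟩
    rw [show (fun i => ((-m) i : ℝ)) = -fun i => (m i : ℝ) by funext i; simp]
    rw [Matrix.mulVec_neg]

theorem mulVec_mem_lat_mul_iff {T B : Matrix (Fin 2) (Fin 2) ℝ} (hT : IsUnit T)
    (x : Fin 2 → ℝ) : T *ᵥ x ∈ lat (T * B) ↔ x ∈ lat B := by
  refine exists_congr fun m => ?_
  rw [← Matrix.mulVec_mulVec]
  exact (Matrix.mulVec_injective_of_isUnit hT).eq_iff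

theorem bijOn_mulVec_lat {T : Matrix (Fin 2) (Fin 2) ℝ} (hT : IsUnit T)
    (B : Matrix (Fin 2) (Fin 2) ℝ) :
    Set.BijOn (fun x => T *ᵥ x) (lat B : Set (Fin 2 → ℝ)) (lat (T * B) : Set (Fin 2 → ℝ)) := by
  refine ⟨fun x hx => (mulVec_mem_lat_mul_iff hT x).2 hx,
    (Matrix.mulVec_injective_of_isUnit hT).injOn, ?_⟩
  rintro _ ⟨m, rfl⟩
  exact ⟨B *ᵥ fun i => (m i : ℝ), ⟨m, rfl⟩, Matrix.mulVec_mulVec _ _ _⟩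

theorem exists_torus_addEquiv {T : Matrix (Fin 2) (Fin 2) ℝ} (hT : IsUnit T)
    (B : Matrix (Fin 2) (Fin 2) ℝ) :
    ∃ e : ((Fin 2 → ℝ) ⧸ lat B) ≃+ ((Fin 2 → ℝ) ⧸ lat (T * B)),
      ∀ x : Fin 2 → ℝ, e (QuotientAddGroup.mk x) = QuotientAddGroup.mk (T *ᵥ x) := by
  let f : (Fin 2 → ℝ) ≃+ (Fin 2 → ℝ) :=
    AddEquiv.ofBijective T.mulVecLin.toAddMonoidHom
      ⟨Matrix.mulVec_injective_of_isUnit hT, Matrix.mulVec_surjective_iff_isUnit.2 hT⟩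
  have hf : (lat B).map (f : (Fin 2 → ℝ) →+ (Fin 2 → ℝ)) = lat (T * B) :=
    SetLike.coe_injective (bijOn_mulVec_lat hT B).image_eq
  exact ⟨QuotientAddGroup.congr _ _ f hf, fun _ => rfl⟩

/-- The disregistry `b₂₁` is an isomorphism from the moiré cell to the unit
cell of layer 1: `(I - A₁A₂⁻¹) A_M = A₁`, the linear map `x ↦ (I - A₁A₂⁻¹)x`
maps the moiré lattice `A_Mℤ²` bijectively onto `A₁ℤ²`, and it induces an
additive group isomorphism of the tori `ℝ²/A_Mℤ² ≃+ ℝ²/A₁ℤ²`. -/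
theorem disregistry_b21_iso
    (A₁ A₂ : Matrix (Fin 2) (Fin 2) ℝ)
    (h₁ : IsUnit A₁.det) (h₂ : IsUnit A₂.det)
    (hM : IsUnit (A₁⁻¹ - A₂⁻¹).det) :
    (1 - A₁ * A₂⁻¹) * (A₁⁻¹ - A₂⁻¹)⁻¹ = A₁ ∧
    Set.BijOn (fun x => (1 - A₁ * A₂⁻¹).mulVec x)
      (lat ((A₁⁻¹ - A₂⁻¹)⁻¹) : Set (Fin 2 → ℝ)) (lat A₁ : Set (Fin 2 → ℝ)) ∧
    ∃ e : ((Fin 2 → ℝ) ⧸ lat ((A₁⁻¹ - A₂⁻¹)⁻¹)) ≃+ ((Fin 2 → ℝ) ⧸ lat A₁),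
      ∀ x : Fin 2 → ℝ,
        e (QuotientAddGroup.mk x) = QuotientAddGroup.mk ((1 - A₁ * A₂⁻¹).mulVec x) := by
  have hT : 1 - A₁ * A₂⁻¹ = A₁ * (A₁⁻¹ - A₂⁻¹) := by
    rw [mul_sub, Matrix.mul_nonsing_inv _ h₁]
  have hA : (1 - A₁ * A₂⁻¹) * (A₁⁻¹ - A₂⁻¹)⁻¹ = A₁ := by
    rw [hT, Matrix.mul_nonsing_inv_cancel_right _ _ hM]
  have hU : IsUnit (1 - A₁ * A₂⁻¹) := by
    rw [hT]
    exact ((Matrix.isUnit_iff_isUnit_det _).2 h₁).mul ((Matrix.isUnit_iff_isUnit_det _).2 hM)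
  have hbij := bijOn_mulVec_lat hU (A₁⁻¹ - A₂⁻¹)⁻¹
  have hiso := exists_torus_addEquiv hU (A₁⁻¹ - A₂⁻¹)⁻¹
  rw [hA] at hbij hiso
  exact ⟨hA, hbij, hiso⟩
end

section
/- Let A₁, A₂ be invertible real 2×2 matrices with A₁⁻¹ - A₂⁻¹ invertible and A_M = (A₁⁻¹ - A₂⁻¹)⁻¹. Then (I - A₂A₁⁻¹) A_M = -A₂; consequently the linear map x ↦ (I - A₂A₁⁻¹)x maps the moiré lattice A_Mℤ² bijectively onto the lattice A₂ℤ² and induces an additive group isomorphism between the tori ℝ²/A_Mℤ² and ℝ²/A₂ℤ². Moreover the exact identity (I - A₂A₁⁻¹) = -A₂A₁⁻¹ (I - A₁A₂⁻¹) holds, so b₁₂(x) = -A₂A₁⁻¹ b₂₁(x) for all x ∈ ℝ². -/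
open Matrix

theorem lat_neg (B : Matrix (Fin 2) (Fin 2) ℝ) : lat (-B) = lat B := by
  ext v
  constructor
  all_goals
    rintro ⟨m, rfl⟩
    refine ⟨-m, ?_⟩
    rw [show (fun i => ((-m) i : ℝ)) = -fun i => (m i : ℝ) by funext i; simp]
    simp [Matrix.neg_mulVec, Matrix.mulVec_neg]

theorem image_mulVec_lat (P B : Matrix (Fin 2) (Fin 2) ℝ) :
    (fun x => P.mulVec x) '' (lat B : Set (Fin 2 → ℝ)) = lat (P * B) := by
  ext v
  constructor
  · rintro ⟨_, ⟨m, rfl⟩, rfl⟩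
    exact ⟨m, Matrix.mulVec_mulVec _ _ _⟩
  · rintro ⟨m, rfl⟩
    exact ⟨_, ⟨m, rfl⟩, Matrix.mulVec_mulVec _ _ _⟩

/-- The disregistry `b₁₂` is an isomorphism from the moiré cell to the unit
cell of layer 2: `(I - A₂A₁⁻¹) A_M = -A₂`, the linear map `x ↦ (I - A₂A₁⁻¹)x`
maps the moiré lattice `A_Mℤ²` bijectively onto `A₂ℤ²` and induces an additive
group isomorphism of the tori `ℝ²/A_Mℤ² ≃+ ℝ²/A₂ℤ²`; moreover
`I - A₂A₁⁻¹ = -A₂A₁⁻¹(I - A₁A₂⁻¹)`, so `b₁₂(x) = -A₂A₁⁻¹ b₂₁(x)` for all `x`. -/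
theorem disregistry_b12_iso
    (A₁ A₂ : Matrix (Fin 2) (Fin 2) ℝ)
    (h₁ : IsUnit A₁.det) (h₂ : IsUnit A₂.det)
    (hM : IsUnit (A₁⁻¹ - A₂⁻¹).det) :
    (1 - A₂ * A₁⁻¹) * (A₁⁻¹ - A₂⁻¹)⁻¹ = -A₂ ∧
    Set.BijOn (fun x => (1 - A₂ * A₁⁻¹).mulVec x)
      (lat ((A₁⁻¹ - A₂⁻¹)⁻¹) : Set (Fin 2 → ℝ)) (lat A₂ : Set (Fin 2 → ℝ)) ∧
    (∃ e : ((Fin 2 → ℝ) ⧸ lat ((A₁⁻¹ - A₂⁻¹)⁻¹)) ≃+ ((Fin 2 → ℝ) ⧸ lat A₂),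
      ∀ x : Fin 2 → ℝ,
        e (QuotientAddGroup.mk x) = QuotientAddGroup.mk ((1 - A₂ * A₁⁻¹).mulVec x)) ∧
    (1 - A₂ * A₁⁻¹) = -(A₂ * A₁⁻¹) * (1 - A₁ * A₂⁻¹) ∧
    ∀ x : Fin 2 → ℝ, (1 - A₂ * A₁⁻¹).mulVec x =
      -((A₂ * A₁⁻¹).mulVec ((1 - A₁ * A₂⁻¹).mulVec x)) := by
  have hfac : 1 - A₂ * A₁⁻¹ = -(A₂ * (A₁⁻¹ - A₂⁻¹)) := by
    rw [Matrix.mul_sub, Matrix.mul_nonsing_inv _ h₂, neg_sub]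
  have hmul : (1 - A₂ * A₁⁻¹) * (A₁⁻¹ - A₂⁻¹)⁻¹ = -A₂ := by
    rw [hfac, Matrix.neg_mul, Matrix.mul_assoc, Matrix.mul_nonsing_inv _ hM, Matrix.mul_one]
  have hdet : IsUnit (1 - A₂ * A₁⁻¹).det := by
    rw [hfac, Matrix.det_neg, Matrix.det_mul]
    exact (isUnit_one.neg.pow _).mul (h₂.mul hM)
  have himage : (fun x => (1 - A₂ * A₁⁻¹).mulVec x) ''
      (lat ((A₁⁻¹ - A₂⁻¹)⁻¹) : Set (Fin 2 → ℝ)) = lat A₂ := by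
    rw [image_mulVec_lat, hmul, lat_neg]
  have hid : (1 - A₂ * A₁⁻¹) = -(A₂ * A₁⁻¹) * (1 - A₁ * A₂⁻¹) := by
    rw [Matrix.mul_sub, Matrix.mul_one, Matrix.neg_mul, Matrix.mul_assoc A₂,
      Matrix.nonsing_inv_mul_cancel_left _ _ h₁, Matrix.mul_nonsing_inv _ h₂]
    abel
  refine ⟨hmul, ?_, ?_, hid, fun x => ?_⟩
  · rw [← himage]
    exact (Matrix.mulVec_injective_of_isUnit
      ((Matrix.isUnit_iff_isUnit_det _).2 hdet)).injOn.bijOn_image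
  · let f : (Fin 2 → ℝ) ≃+ (Fin 2 → ℝ) := (Matrix.toLin'OfInv
      (Matrix.mul_nonsing_inv _ hdet) (Matrix.nonsing_inv_mul _ hdet)).symm.toAddEquiv
    exact ⟨QuotientAddGroup.congr _ _ f (SetLike.coe_injective himage), fun x => rfl⟩
  · rw [Matrix.mulVec_mulVec, ← Matrix.neg_mulVec, ← Matrix.neg_mul, ← hid]
end

section
/- Let A be an invertible real 2×2 matrix and 0 < ε < 2, and set A₁ = diag(1 - ε/2, 1 + ε/2) A and A₂ = diag(1 + ε/2, 1 - ε/2) A (pure shear, i.e., trace-free tensile strain, of the two layers). Then A₁⁻¹ - A₂⁻¹ is invertible and the moiré fundamental matrix is A_M = (A₁⁻¹ - A₂⁻¹)⁻¹ = ((1 - (ε/2)²)/ε) · diag(1, -1) · A; i.e., the pure-shear moiré lattice is the mirror image of the reference lattice along the horizontal axis, scaled by (1 - (ε/2)²)/ε. -/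
open Matrix

/-- For the purely sheared (trace-free strained) layers
`A₁ = diag(1-ε/2, 1+ε/2) A`, `A₂ = diag(1+ε/2, 1-ε/2) A` with `0 < ε < 2`,
the matrix `A₁⁻¹ - A₂⁻¹` is invertible and the moiré fundamental matrix is
`A_M = (A₁⁻¹ - A₂⁻¹)⁻¹ = ((1-(ε/2)²)/ε) diag(1,-1) A`. -/
theorem pure_shear_moire_lattice
    (A : Matrix (Fin 2) (Fin 2) ℝ) (hA : IsUnit A.det)
    (ε : ℝ) (hε0 : 0 < ε) (hε2 : ε < 2)
    (A₁ A₂ : Matrix (Fin 2) (Fin 2) ℝ)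
    (hA₁ : A₁ = !![1 - ε / 2, 0; 0, 1 + ε / 2] * A)
    (hA₂ : A₂ = !![1 + ε / 2, 0; 0, 1 - ε / 2] * A) :
    IsUnit (A₁⁻¹ - A₂⁻¹).det ∧
    (A₁⁻¹ - A₂⁻¹)⁻¹ = ((1 - (ε / 2) ^ 2) / ε) • (!![1, 0; 0, -1] * A) := by
  have hm : 1 - ε / 2 ≠ 0 := by linarith
  have hp : 1 + ε / 2 ≠ 0 := by linarith
  have hε : ε ≠ 0 := hε0.ne'
  have hD₁ : (!![1 - ε / 2, 0; 0, 1 + ε / 2] : Matrix (Fin 2) (Fin 2) ℝ)⁻¹ =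
      !![(1 - ε / 2)⁻¹, 0; 0, (1 + ε / 2)⁻¹] := by
    apply Matrix.inv_eq_right_inv
    simp [Matrix.one_fin_two, hm, hp]
  have hD₂ : (!![1 + ε / 2, 0; 0, 1 - ε / 2] : Matrix (Fin 2) (Fin 2) ℝ)⁻¹ =
      !![(1 + ε / 2)⁻¹, 0; 0, (1 - ε / 2)⁻¹] := by
    apply Matrix.inv_eq_right_inv
    simp [Matrix.one_fin_two, hm, hp]
  have hdiff : (!![(1 - ε / 2)⁻¹, 0; 0, (1 + ε / 2)⁻¹] : Matrix (Fin 2) (Fin 2) ℝ) -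
      !![(1 + ε / 2)⁻¹, 0; 0, (1 - ε / 2)⁻¹] =
      (ε / (1 - (ε / 2) ^ 2)) • !![1, 0; 0, -1] := by
    have hfac : 1 - (ε / 2) ^ 2 = (1 - ε / 2) * (1 + ε / 2) := by ring
    have h : (1 - ε / 2)⁻¹ - (1 + ε / 2)⁻¹ = ε / (1 - (ε / 2) ^ 2) := by
      rw [hfac, inv_sub_inv hm hp]
      congr 1
      ring
    rw [← h]
    ext i j
    fin_cases i <;> fin_cases j <;> simp
  have hscale : ε / (1 - (ε / 2) ^ 2) * ((1 - (ε / 2) ^ 2) / ε) = 1 := by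
    have hq : 1 - (ε / 2) ^ 2 ≠ 0 := by nlinarith
    rw [div_mul_div_cancel₀ hq, div_self hε]
  have hrefl : (!![1, 0; 0, -1] : Matrix (Fin 2) (Fin 2) ℝ) * !![1, 0; 0, -1] = 1 := by
    simp [Matrix.one_fin_two]
  have hinv : (A₁⁻¹ - A₂⁻¹) * (((1 - (ε / 2) ^ 2) / ε) • (!![1, 0; 0, -1] * A)) = 1 := by
    rw [hA₁, hA₂, Matrix.mul_inv_rev, Matrix.mul_inv_rev, hD₁, hD₂, ← Matrix.mul_sub, hdiff,
      Matrix.mul_smul, Matrix.mul_smul, Matrix.smul_mul, smul_smul, mul_comm, hscale, one_smul,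
      Matrix.mul_assoc, ← Matrix.mul_assoc _ _ A, hrefl, Matrix.one_mul,
      Matrix.nonsing_inv_mul A hA]
  exact ⟨Matrix.isUnit_det_of_right_inverse hinv, Matrix.inv_eq_right_inv hinv⟩
end

section
/- Let A be an invertible real 2×2 matrix and ε ≠ 0, and set A₁ = [[1, -ε/2],[0, 1]] A and A₂ = [[1, ε/2],[0, 1]] A (horizontal simple shear of the two layers). Then A₁⁻¹ - A₂⁻¹ = ε A⁻¹ [[0, 1],[0, 0]]; in particular det(A₁⁻¹ - A₂⁻¹) = 0, the matrix A₁⁻¹ - A₂⁻¹ has rank one and is not invertible, so the simple-shear moiré lattice does not have full rank (the moiré pattern is one-dimensional). -/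
open Matrix

/-- The inverse of a horizontal shear is the opposite shear. -/
theorem inv_horizontal_shear (t : ℝ) :
    (!![1, t; 0, 1] : Matrix (Fin 2) (Fin 2) ℝ)⁻¹ = !![1, -t; 0, 1] := by
  apply Matrix.inv_eq_right_inv
  ext i j
  fin_cases i <;> fin_cases j <;> simp [Matrix.mul_apply, Fin.sum_univ_two]

/-- A nonzero multiple of the nilpotent matrix `[[0,1],[0,0]]` has rank one. -/
theorem rank_smul_nilpotent {ε : ℝ} (hε : ε ≠ 0) :
    (ε • !![0, 1; 0, 0] : Matrix (Fin 2) (Fin 2) ℝ).rank = 1 := by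
  have h : (ε • !![0, 1; 0, 0] : Matrix (Fin 2) (Fin 2) ℝ) = vecMulVec ![ε, 0] ![0, 1] := by
    ext i j
    fin_cases i <;> fin_cases j <;> simp [vecMulVec_apply]
  apply le_antisymm
  · rw [h]
    exact rank_vecMulVec_le _ _
  · rw [Nat.one_le_iff_ne_zero, Ne, Matrix.rank, Submodule.finrank_eq_zero,
      LinearMap.range_eq_bot]
    intro h0
    exact hε (by simpa using congrFun (LinearMap.congr_fun h0 ![0, 1]) 0)

/-- For the simply sheared layers `A₁ = [[1,-ε/2],[0,1]]A`,
`A₂ = [[1,ε/2],[0,1]]A` with `ε ≠ 0`, one has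
`A₁⁻¹ - A₂⁻¹ = ε A⁻¹ [[0,1],[0,0]]`; in particular this matrix has determinant
zero, is not invertible, and has rank one, so the simple-shear moiré lattice
does not have full rank. -/
theorem simple_shear_moire_degenerate
    (A : Matrix (Fin 2) (Fin 2) ℝ) (hA : IsUnit A.det)
    (ε : ℝ) (hε : ε ≠ 0)
    (A₁ A₂ : Matrix (Fin 2) (Fin 2) ℝ)
    (hA₁ : A₁ = !![1, -(ε / 2); 0, 1] * A)
    (hA₂ : A₂ = !![1, ε / 2; 0, 1] * A) :
    A₁⁻¹ - A₂⁻¹ = ε • (A⁻¹ * !![0, 1; 0, 0]) ∧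
    (A₁⁻¹ - A₂⁻¹).det = 0 ∧
    ¬ IsUnit (A₁⁻¹ - A₂⁻¹).det ∧
    (A₁⁻¹ - A₂⁻¹).rank = 1 := by
  have key : A₁⁻¹ - A₂⁻¹ = ε • (A⁻¹ * !![0, 1; 0, 0]) := by
    rw [hA₁, hA₂, Matrix.mul_inv_rev, Matrix.mul_inv_rev, inv_horizontal_shear,
      inv_horizontal_shear, ← Matrix.mul_sub, ← Matrix.mul_smul]
    congr 1
    ext i j
    fin_cases i <;> fin_cases j <;> simp
  have hdet : (A₁⁻¹ - A₂⁻¹).det = 0 := by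
    rw [key, Matrix.det_smul, Matrix.det_mul]
    simp [Matrix.det_fin_two_of]
  refine ⟨key, hdet, by simp [hdet], ?_⟩
  rw [key, ← Matrix.mul_smul,
    Matrix.rank_mul_eq_right_of_isUnit_det _ _ (Matrix.isUnit_nonsing_inv_det A hA),
    rank_smul_nilpotent hε]
end
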